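/- Let x, κ, θ, η ∈ ℝ and set σ^OU := (x·𝟙 + κθ·e_1 + η·e_2) ⊗ exp_⧢(−κ·e_1) ∈ T((ℝ²)). Then σ^OU solves the linear algebraic equation σ^OU = (x·𝟙 + κθ·e_1 + η·e_2) − κ·(σ^OU ⊗ e_1). -/

import Mathlib

/-- Words over the alphabet `{1, …, d}`, modeled as lists over `Fin d`. -/
abbrev Word (d : ℕ) := List (Fin d)

/-- The extended tensor algebra `T((ℝ^d))`, modeled as real-valued functions on words. -/
abbrev Tensor (d : ℕ) := Word d → ℝ

namespace Sig

/-- The unit `𝟙`: the indicator of the empty word. -/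
def unit (d : ℕ) : Tensor d := fun w => if w = [] then 1 else 0

/-- The concatenation product `(ℓ ⊗ p)(w) = Σ_{w = u·v} ℓ(u) p(v)`. -/
def concatProd {d : ℕ} (l p : Tensor d) : Tensor d :=
  fun w => ∑ i ∈ Finset.range (w.length + 1), l (w.take i) * p (w.drop i)

/-- `n`-fold concatenation power, `ℓ^⊗0 = 𝟙`. -/
def concatPow {d : ℕ} (l : Tensor d) : ℕ → Tensor d
  | 0 => unit d
  | n + 1 => concatProd (concatPow l n) l

/-- The letter `e_i`: the indicator of the one-letter word `i`. -/
def letter {d : ℕ} (i : Fin d) : Tensor d := fun w => if w = [i] then 1 else 0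

/-- The shuffle product on `T((ℝ^d))`, the coefficientwise bilinear extension of the
inductive shuffle of words. -/
def shuffle {d : ℕ} : Tensor d → Tensor d → Word d → ℝ
  | l, m, [] => l [] * m []
  | l, m, i :: w => shuffle (fun u => l (i :: u)) m w + shuffle l (fun u => m (i :: u)) w

/-- `n`-fold shuffle power, `ℓ^⧢0 = 𝟙`. -/
def shufflePow {d : ℕ} (l : Tensor d) : ℕ → Tensor d
  | 0 => unit d
  | n + 1 => shuffle (shufflePow l n) l

/-- The resolvent `(𝟙 − q)^{-1} = Σ_{n≥0} q^⊗n`, defined coefficientwise. -/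
noncomputable def resolvent {d : ℕ} (q : Tensor d) : Tensor d :=
  fun w => ∑' n : ℕ, concatPow q n w

/-- The shuffle exponential `exp_⧢(ℓ) = Σ_{n≥0} ℓ^⧢n / n!`, defined coefficientwise. -/
noncomputable def shuffleExp {d : ℕ} (l : Tensor d) : Tensor d :=
  fun w => ∑' n : ℕ, shufflePow l n w / (n.factorial : ℝ)

/-- Right-deconcatenation (projection) by a word `u`: `(ℓ π_u)(w) = ℓ(w·u)`. -/
def proj {d : ℕ} (l : Tensor d) (u : Word d) : Tensor d := fun w => l (w ++ u)

/-- The tensor-algebra representation of the Ornstein–Uhlenbeck process: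
`σ^OU = (x·𝟙 + κθ·e_1 + η·e_2) ⊗ exp_⧢(−κ·e_1)`. -/
noncomputable def sigmaOU (x kappa theta eta : ℝ) : Tensor 2 :=
  concatProd
    (x • unit 2 + (kappa * theta) • letter (0 : Fin 2) + eta • letter (1 : Fin 2))
    (shuffleExp ((-kappa) • letter (0 : Fin 2)))

theorem shuffle_zero_left {d : ℕ} (w : Word d) : ∀ m : Tensor d, shuffle (fun _ => 0) m w = 0 := by
  induction w with
  | nil => intro m; simp [shuffle]
  | cons i w ih => intro m; simp [shuffle, ih]

theorem shuffle_zero_right {d : ℕ} (w : Word d) : ∀ l : Tensor d, shuffle l (fun _ => 0) w = 0 := by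
  induction w with
  | nil => intro m; simp [shuffle]
  | cons i w ih => intro m; simp [shuffle, ih]

theorem shuffle_unit_right {d : ℕ} (c : ℝ) (w : Word d) :
    ∀ l : Tensor d, shuffle l (fun u => if u = [] then c else 0) w = l w * c := by
  induction w with
  | nil => intro m; simp [shuffle]
  | cons i w ih => intro m; simp [shuffle, ih, shuffle_zero_right]

theorem shuffle_letter {d : ℕ} (a : Fin d) (c K : ℝ) (n : ℕ) : ∀ w : Word d,
    shuffle (fun u => if u = List.replicate n a then K else 0)
      (fun u => if u = [a] then c else 0) w =
      if w = List.replicate (n + 1) a then K * c * (n + 1) else 0 := by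
  induction n with
  | zero =>
    intro w
    cases w with
    | nil => simp [shuffle]
    | cons i w =>
      by_cases h : i = a
      · simp [shuffle, shuffle_zero_left, h, shuffle_unit_right]
      · simp [shuffle, shuffle_zero_left, h, shuffle_zero_right]
  | succ n ih =>
    intro w
    cases w with
    | nil => simp [shuffle]
    | cons i w =>
      rw [List.replicate_succ (n := n + 1)]
      by_cases h : i = a
      · have e := ih w
        simp only [shuffle, List.replicate_succ (n := n), h, List.cons.injEq, true_and,
          shuffle_unit_right] at e ⊢
        rw [e]
        split_ifs
        · push_cast; ring
        · simp
      · simp [shuffle, shuffle_zero_left, h, shuffle_zero_right, List.replicate_succ (n := n)]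

theorem smul_letter_eq {d : ℕ} (a : Fin d) (c : ℝ) :
    c • letter a = fun u : Word d => if u = [a] then c else 0 := by
  funext u; simp [letter]

theorem shufflePow_letter {d : ℕ} (a : Fin d) (c : ℝ) (n : ℕ) :
    shufflePow (c • letter a) n =
      fun w => if w = List.replicate n a then c ^ n * (n.factorial : ℝ) else 0 := by
  induction n with
  | zero => funext w; simp [shufflePow, unit]
  | succ n ih =>
    funext w
    rw [shufflePow, ih, smul_letter_eq, shuffle_letter]
    congr 1
    rw [Nat.factorial_succ]; push_cast; ring

theorem shuffleExp_letter {d : ℕ} (a : Fin d) (c : ℝ) (w : Word d) :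
    shuffleExp (c • letter a) w = if w = List.replicate w.length a then c ^ w.length else 0 := by
  rw [shuffleExp, tsum_eq_single w.length]
  · rw [shufflePow_letter]
    have : (w.length.factorial : ℝ) ≠ 0 := by positivity
    simp only
    split_ifs
    · field_simp
    · simp
  · intro n hn
    rw [shufflePow_letter]
    have : w ≠ List.replicate n a := by
      intro h; apply hn; rw [h]; simp
    simp [this]

theorem shuffleExp_letter_nil {d : ℕ} (a : Fin d) (c : ℝ) :
    shuffleExp (c • letter a) [] = 1 := by
  simp [shuffleExp_letter]

theorem shuffleExp_letter_append {d : ℕ} (a i : Fin d) (c : ℝ) (w : Word d) :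
    shuffleExp (c • letter a) (w ++ [i]) =
      shuffleExp (c • letter a) w * (if i = a then c else 0) := by
  have key : (w ++ [i] = List.replicate (w ++ [i]).length a) ↔
      (w = List.replicate w.length a ∧ i = a) := by
    simp only [List.eq_replicate_iff, true_and, List.mem_append, List.mem_singleton]
    constructor
    · intro h; exact ⟨fun b hb => h b (Or.inl hb), h i (Or.inr rfl)⟩
    · rintro ⟨h1, h2⟩ b (hb | rfl)
      · exact h1 b hb
      · exact h2
  rw [shuffleExp_letter, shuffleExp_letter]
  simp only [key]
  by_cases h1 : w = List.replicate w.length a <;> by_cases h2 : i = a <;>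
    simp only [h2, and_true, and_false, if_true, if_false, mul_zero]
  · rw [if_pos h1, if_pos h1]; simp [pow_succ]
  · rw [if_neg h1, if_neg h1]; simp

theorem concatProd_exp_append {d : ℕ} (A : Tensor d) (a i : Fin d) (c : ℝ) (w : Word d) :
    concatProd A (shuffleExp (c • letter a)) (w ++ [i]) =
      A (w ++ [i]) +
        concatProd A (shuffleExp (c • letter a)) w * (if i = a then c else 0) := by
  unfold concatProd
  rw [List.length_append, List.length_singleton, Finset.sum_range_succ, add_comm,
    Finset.sum_mul]
  congr 1
  · rw [List.take_of_length_le (by simp), List.drop_of_length_le (by simp),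
      shuffleExp_letter_nil, mul_one]
  · refine Finset.sum_congr rfl fun j hj => ?_
    have hj' : j ≤ w.length := by
      have := Finset.mem_range.mp hj; omega
    rw [List.take_append_of_le_length hj', List.drop_append_of_le_length hj',
      shuffleExp_letter_append, mul_assoc]

theorem concatProd_letter_append {d : ℕ} (l : Tensor d) (a i : Fin d) (w : Word d) :
    concatProd l (letter a) (w ++ [i]) = l w * (if i = a then 1 else 0) := by
  unfold concatProd
  rw [List.length_append, List.length_singleton, Finset.sum_range_succ, Finset.sum_range_succ,
    Finset.sum_eq_zero]
  · simp [letter]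
  · intro j hj
    have hj' := Finset.mem_range.mp hj
    have : (w ++ [i]).drop j ≠ [a] := by
      intro h
      have := congrArg List.length h
      simp at this
      omega
    simp [letter, this]

theorem concat_exp_solves {d : ℕ} (A : Tensor d) (a : Fin d) (k : ℝ) :
    concatProd A (shuffleExp ((-k) • letter a)) =
      A - k • concatProd (concatProd A (shuffleExp ((-k) • letter a))) (letter a) := by
  funext w
  rw [Pi.sub_apply, Pi.smul_apply]
  rcases List.eq_nil_or_concat w with rfl | ⟨w, i, rfl⟩
  · have h1 : concatProd A (shuffleExp ((-k) • letter a)) [] = A [] := by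
      unfold concatProd
      simp [shuffleExp_letter_nil, -neg_smul]
    rw [h1]
    simp [concatProd, letter]
  · rw [List.concat_eq_append, concatProd_letter_append, concatProd_exp_append]
    split_ifs
    · simp only [smul_eq_mul]; ring
    · simp

/-- `σ^OU` solves `σ^OU = (x·𝟙 + κθ·e_1 + η·e_2) − κ·(σ^OU ⊗ e_1)`. -/
theorem sigmaOU_solves_linear_eq (x kappa theta eta : ℝ) :
    sigmaOU x kappa theta eta =
      (x • unit 2 + (kappa * theta) • letter (0 : Fin 2) + eta • letter (1 : Fin 2)) -
        kappa • concatProd (sigmaOU x kappa theta eta) (letter (0 : Fin 2)) := by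
  exact concat_exp_solves _ _ _

end Sig
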